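/- arXiv:1310.5131 — 3 statements merged into one kernel-verified Lean document; each statement's English description precedes it below -/
import Mathlib

section
/- (Lemma 1) Let d ≥ 1, let t₁, t₂ ∈ ℝ, and let ε₁ᴰ, ε₂ᴰ be d×d real matrices. Assume the matrix E := t₁·ε₂ᴰ - t₂·ε₁ᴰ is invertible. Then the 2d×2d block matrix A with blocks A = [[(t₁/d)·1, ε₁ᴰ], [(t₂/d)·1, ε₂ᴰ]] is invertible, and its inverse equals the block matrix [[d·ε₂ᴰ·E⁻¹, -d·ε₁ᴰ·E⁻¹], [-t₂·E⁻¹, t₁·E⁻¹]]. -/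
/-- Lemma 1: explicit inverse of the block matrix
`A = [[(t₁/d)·1, ε₁ᴰ], [(t₂/d)·1, ε₂ᴰ]]` when `E = t₁ε₂ᴰ - t₂ε₁ᴰ` is invertible. -/
theorem blockMatrix_inverse (d : ℕ) (hd : 1 ≤ d) (t₁ t₂ : ℝ)
    (ε₁D ε₂D : Matrix (Fin d) (Fin d) ℝ)
    (E : Matrix (Fin d) (Fin d) ℝ) (hE : E = t₁ • ε₂D - t₂ • ε₁D)
    (hEinv : IsUnit E)
    (A : Matrix (Fin d ⊕ Fin d) (Fin d ⊕ Fin d) ℝ)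
    (hA : A = Matrix.fromBlocks
      ((t₁ / d) • (1 : Matrix (Fin d) (Fin d) ℝ)) ε₁D
      ((t₂ / d) • (1 : Matrix (Fin d) (Fin d) ℝ)) ε₂D) :
    IsUnit A ∧
      A⁻¹ = Matrix.fromBlocks
        ((d : ℝ) • (ε₂D * E⁻¹)) (-((d : ℝ) • (ε₁D * E⁻¹)))
        (-(t₂ • E⁻¹)) (t₁ • E⁻¹) := by
  have hd' : (d : ℝ) ≠ 0 := by positivity
  have hEE : t₁ • (ε₂D * E⁻¹) - t₂ • (ε₁D * E⁻¹) = 1 := by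
    rw [← Matrix.smul_mul, ← Matrix.smul_mul, ← Matrix.sub_mul, ← hE]
    exact Matrix.mul_nonsing_inv E ((Matrix.isUnit_iff_isUnit_det E).mp hEinv)
  have hAB : A * Matrix.fromBlocks
      ((d : ℝ) • (ε₂D * E⁻¹)) (-((d : ℝ) • (ε₁D * E⁻¹)))
      (-(t₂ • E⁻¹)) (t₁ • E⁻¹) = 1 := by
    rw [hA, Matrix.fromBlocks_multiply, ← Matrix.fromBlocks_one]
    simp only [Matrix.smul_mul, Matrix.one_mul, Matrix.mul_neg, Matrix.mul_smul,
      smul_smul, mul_div_cancel₀ _ hd', ← sub_eq_add_neg, neg_add_eq_sub, sub_self, hEE]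
  exact ⟨IsUnit.of_mul_eq_one _ hAB, Matrix.inv_eq_right_inv hAB⟩
end

section
/- (Proposition 1, case d = 3) Let ε₁, ε₂ be symmetric 3×3 real matrices with traces t₁ := trace(ε₁), t₂ := trace(ε₂), and set E := t₁·ε₂ᴰ - t₂·ε₁ᴰ where εₙᴰ := εₙ - (tₙ/3)·1. Then det(E) = 0 if and only if there exist a scalar γ ∈ ℝ and two unit vectors φ₁, φ₂ ∈ ℝ³ with φ₁ ⊥ φ₂ such that t₁·ε₂ = t₂·ε₁ + γ·(φ₁φ₁ᵀ - φ₂φ₂ᵀ), where φφᵀ denotes the rank-one outer-product matrix. -/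
open scoped BigOperators

/-- Spectral decomposition of a real symmetric matrix as a combination of the rank-one projections
onto an orthonormal eigenbasis. -/
theorem Matrix.IsSymm.exists_eq_sum_smul_vecMulVec {n : Type*} [Fintype n] [DecidableEq n]
    {A : Matrix n n ℝ} (hA : A.IsSymm) :
    ∃ (l : n → ℝ) (v : n → n → ℝ),
      (∀ i j, ∑ k, v i k * v j k = if i = j then 1 else 0) ∧
      A = ∑ i, l i • Matrix.vecMulVec (v i) (v i) ∧
      A.trace = ∑ i, l i ∧ A.det = ∏ i, l i := by
  have hH : A.IsHermitian := by
    rw [Matrix.IsHermitian, Matrix.conjTranspose_eq_transpose_of_trivial]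
    exact hA
  refine ⟨hH.eigenvalues, fun i k => hH.eigenvectorBasis i k, fun i j => ?_, ?_, ?_, ?_⟩
  · have h := orthonormal_iff_ite.mp hH.eigenvectorBasis.orthonormal i j
    rw [← h, PiLp.inner_apply]
    exact Finset.sum_congr rfl fun k _ => by simp [mul_comm]
  · ext a b
    have h := congrFun (congrFun hH.spectral_theorem a) b
    rw [Unitary.conjStarAlgAut_apply, Matrix.mul_apply] at h
    rw [h, Matrix.sum_apply]
    refine Finset.sum_congr rfl fun k _ => ?_
    simp [Matrix.mul_diagonal, Matrix.star_apply, Matrix.IsHermitian.eigenvectorUnitary_apply,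
      Matrix.vecMulVec_apply]
    ring
  · simpa using hH.trace_eq_sum_eigenvalues
  · simpa using hH.det_eq_prod_eigenvalues

/-- A real symmetric traceless `3 × 3` matrix with zero determinant has spectrum `{γ, -γ, 0}`. -/
theorem Matrix.IsSymm.exists_eq_smul_vecMulVec_sub {A : Matrix (Fin 3) (Fin 3) ℝ}
    (hA : A.IsSymm) (htr : A.trace = 0) (hdet : A.det = 0) :
    ∃ (γ : ℝ) (φ₁ φ₂ : Fin 3 → ℝ),
      (∑ i, φ₁ i * φ₁ i) = 1 ∧ (∑ i, φ₂ i * φ₂ i) = 1 ∧ (∑ i, φ₁ i * φ₂ i) = 0 ∧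
      A = γ • (Matrix.vecMulVec φ₁ φ₁ - Matrix.vecMulVec φ₂ φ₂) := by
  obtain ⟨l, v, hv, hsum, ht, hd⟩ := hA.exists_eq_sum_smul_vecMulVec
  have key : ∀ i j k : Fin 3, i ≠ j → l k = 0 → l j = -l i →
      A = l i • Matrix.vecMulVec (v i) (v i) + l j • Matrix.vecMulVec (v j) (v j) +
        l k • Matrix.vecMulVec (v k) (v k) →
      ∃ (γ : ℝ) (φ₁ φ₂ : Fin 3 → ℝ),
        (∑ i, φ₁ i * φ₁ i) = 1 ∧ (∑ i, φ₂ i * φ₂ i) = 1 ∧ (∑ i, φ₁ i * φ₂ i) = 0 ∧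
        A = γ • (Matrix.vecMulVec φ₁ φ₁ - Matrix.vecMulVec φ₂ φ₂) := by
    intro i j k hij hk hj h
    refine ⟨l i, v i, v j, by simp [hv], by simp [hv], by simp [hv, hij], ?_⟩
    rw [h, hk, hj]
    module
  rw [htr, Fin.sum_univ_three] at ht
  rw [hdet, Fin.prod_univ_three] at hd
  rw [Fin.sum_univ_three] at hsum
  rcases mul_eq_zero.mp hd.symm with h | h
  · rcases mul_eq_zero.mp h with h | h
    · exact key 1 2 0 (by decide) h (by linarith) (by rw [hsum]; abel)
    · exact key 0 2 1 (by decide) h (by linarith) (by rw [hsum]; abel)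
  · exact key 0 1 2 (by decide) h (by linarith) hsum

/-- Proposition 1, case `d = 3`: `det E = 0` iff
`t₁ε₂ = t₂ε₁ + γ(φ₁⊗φ₁ - φ₂⊗φ₂)` for some scalar `γ` and orthogonal unit
vectors `φ₁, φ₂`. -/
theorem E_det_eq_zero_iff_three_dim
    (ε₁ ε₂ : Matrix (Fin 3) (Fin 3) ℝ) (h₁ : ε₁.IsSymm) (h₂ : ε₂.IsSymm)
    (t₁ t₂ : ℝ) (ht₁ : t₁ = ε₁.trace) (ht₂ : t₂ = ε₂.trace)
    (ε₁D ε₂D E : Matrix (Fin 3) (Fin 3) ℝ)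
    (hε₁D : ε₁D = ε₁ - (t₁ / 3) • (1 : Matrix (Fin 3) (Fin 3) ℝ))
    (hε₂D : ε₂D = ε₂ - (t₂ / 3) • (1 : Matrix (Fin 3) (Fin 3) ℝ))
    (hE : E = t₁ • ε₂D - t₂ • ε₁D) :
    E.det = 0 ↔
      ∃ (γ : ℝ) (φ₁ φ₂ : Fin 3 → ℝ),
        (∑ i, φ₁ i * φ₁ i) = 1 ∧ (∑ i, φ₂ i * φ₂ i) = 1 ∧
        (∑ i, φ₁ i * φ₂ i) = 0 ∧
        t₁ • ε₂ = t₂ • ε₁ + γ • (Matrix.vecMulVec φ₁ φ₁ - Matrix.vecMulVec φ₂ φ₂) := by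
  have hE' : E = t₁ • ε₂ - t₂ • ε₁ := by
    rw [hE, hε₁D, hε₂D]
    module
  constructor
  · intro hdet
    have hsymm : E.IsSymm := hE' ▸ (h₂.smul t₁).sub (h₁.smul t₂)
    have htr : E.trace = 0 := by
      rw [hE', Matrix.trace_sub, Matrix.trace_smul, Matrix.trace_smul, ← ht₁, ← ht₂]
      simp [mul_comm]
    obtain ⟨γ, φ₁, φ₂, hφ₁, hφ₂, hφ, h⟩ := hsymm.exists_eq_smul_vecMulVec_sub htr hdet
    exact ⟨γ, φ₁, φ₂, hφ₁, hφ₂, hφ, by rw [← h, hE']; abel⟩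
  · rintro ⟨γ, φ₁, φ₂, -, -, -, h⟩
    rw [hE', h, add_sub_cancel_left, Matrix.det_fin_three]
    simp only [Matrix.smul_apply, Matrix.sub_apply, Matrix.vecMulVec_apply, smul_eq_mul]
    ring
end

section
/- (Abstract form of Proposition 3) Let H and K be real Hilbert spaces, let L, L_δ : H → K be continuous linear maps, and suppose there exists c > 0 such that c·‖x‖ ≤ ‖L_δ x‖ for all x ∈ H. Let u, u_δ ∈ H and g, g_δ ∈ K satisfy L u = g and ⟨L_δ u_δ, L_δ v⟩ = ⟨g_δ, L_δ v⟩ for all v ∈ H. Then ‖u_δ - u‖ ≤ c⁻¹·( ‖g_δ - g‖ + ‖(L - L_δ) u‖ ). -/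
open scoped RealInnerProductSpace

/-- Abstract form of Proposition 3: stability of the least-squares solution
with respect to perturbations of the operator and the right-hand side. -/
theorem least_squares_stability
    {H K : Type*}
    [NormedAddCommGroup H] [InnerProductSpace ℝ H] [CompleteSpace H]
    [NormedAddCommGroup K] [InnerProductSpace ℝ K] [CompleteSpace K]
    (L Lδ : H →L[ℝ] K) (c : ℝ) (hc : 0 < c)
    (hcoer : ∀ x : H, c * ‖x‖ ≤ ‖Lδ x‖)
    (u uδ : H) (g gδ : K)
    (hu : L u = g)
    (huδ : ∀ v : H, ⟪Lδ uδ, Lδ v⟫ = ⟪gδ, Lδ v⟫) :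
    ‖uδ - u‖ ≤ c⁻¹ * (‖gδ - g‖ + ‖(L - Lδ) u‖) := by
  have hsplit : gδ - Lδ u = (gδ - g) + (L - Lδ) u := by
    rw [sub_apply, hu]
    abel
  have hres : ‖Lδ (uδ - u)‖ ≤ ‖gδ - Lδ u‖ := by
    have horth : ⟪Lδ (uδ - u), Lδ (uδ - u)⟫ = ⟪gδ - Lδ u, Lδ (uδ - u)⟫ := by
      conv_lhs => rw [map_sub Lδ uδ u, inner_sub_left, ← map_sub, huδ, ← inner_sub_left]
    have hle := real_inner_le_norm (gδ - Lδ u) (Lδ (uδ - u))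
    rw [← horth, real_inner_self_eq_norm_mul_norm] at hle
    rcases (norm_nonneg (Lδ (uδ - u))).eq_or_lt with h0 | hpos
    · exact h0 ▸ norm_nonneg _
    · exact le_of_mul_le_mul_right hle hpos
  rw [le_inv_mul_iff₀ hc]
  calc c * ‖uδ - u‖ ≤ ‖Lδ (uδ - u)‖ := hcoer _
    _ ≤ ‖gδ - Lδ u‖ := hres
    _ ≤ ‖gδ - g‖ + ‖(L - Lδ) u‖ := hsplit ▸ norm_add_le _ _
end
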